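/- Let Q = k[x,y,z]_{(x,y,z)} with maximal ideal m, let M be the cokernel of φ: Q^4 → Q^2 given by the matrix ((y^2, x^2, z^3, 0), (0, 0, z^2, x^2)), and let R = G_m(Q) = k[x,y,z]. Then the complex 0 → R(−4)^2 →^{in(ψ)} R(−2)^4 →^{in(φ)} R^2 → 0, where in(φ) = ((y^2, x^2, 0, 0), (0, 0, z^2, x^2)) and in(ψ) has columns (−x^2, y^2, 0, 0) and (0, 0, −x^2, z^2), is a minimal graded free resolution of the associated graded module G_m(M); in particular G_m(M) has a pure resolution of type (0, 2, 4). -/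

import Mathlib

/-!
STATEMENT 19: Let `Q = k[x,y,z]_{(x,y,z)}` with maximal ideal `m`, let `M` be the cokernel of
`φ : Q^4 → Q^2` with matrix `((y², x², z³, 0), (0, 0, z², x²))`, and let
`R = G_m(Q) = k[x,y,z]`.  Then the complex
`0 → R(−4)^2 →^{in(ψ)} R(−2)^4 →^{in(φ)} R^2 → 0`, with
`in(φ) = ((y², x², 0, 0), (0, 0, z², x²))` and `in(ψ)` having columns `(−x², y², 0, 0)` and
`(0, 0, −x², z²)`, is a minimal graded free resolution of `G_m(M)`; in particular `G_m(M)`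
has a pure resolution of type `(0, 2, 4)`.

Encoding: `Q` is the localization of `R = MvPolynomial (Fin 3) k` at the prime ideal
`(x,y,z)` (primality supplied as an instance argument), `M` is any module with a surjection
`π : Q^2 → M` whose kernel is the column space of `φ`.  The degree-`t` part of
`G_m(F) = R^b` of a free module consists of vectors of homogeneous degree-`t` polynomials,
that of `G_m(M)` is `m^t M/m^{t+1} M`, and the augmentation `ε : R^2 → G_m(M)` sends a
homogeneous degree-`t` vector `v` to the class of `π(v)`.  Being a minimal graded free
resolution of `G_m(M)` is expressed by: exactness at `R(−2)^4`, injectivity of `in(ψ)`,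
`ε ∘ in(φ) = 0`, exactness at `R^2` (`ker ε ⊆ im in(φ)`), surjectivity of `ε`, and
homogeneity of the entries in degrees `2 = 2−0` and `2 = 4−2` (purity of type `(0,2,4)`,
with positive degrees: minimality).
-/

noncomputable section
open MvPolynomial

namespace PureResLoc19

variable (k : Type) [Field k]

abbrev P3 := MvPolynomial (Fin 3) k

/-- the maximal ideal `(x, y, z)` of `k[x,y,z]`. -/
def P : Ideal (P3 k) :=
  Ideal.span {MvPolynomial.X 0, MvPolynomial.X 1, MvPolynomial.X 2}

variable [hP : (P k).IsPrime]

/-- `Q = k[x,y,z]_{(x,y,z)}`. -/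
abbrev Q := Localization (P k).primeCompl

/-- the maximal ideal `m` of `Q`. -/
def mQ : Ideal (Q k) := IsLocalRing.maximalIdeal (Q k)

/-- the matrix `((y², x², z³, 0), (0, 0, z², x²))` of `φ : Q⁴ → Q²`. -/
def phi : Matrix (Fin 2) (Fin 4) (Q k) :=
  !![algebraMap (P3 k) (Q k) (X 1 ^ 2), algebraMap (P3 k) (Q k) (X 0 ^ 2),
       algebraMap (P3 k) (Q k) (X 2 ^ 3), 0;
     0, 0, algebraMap (P3 k) (Q k) (X 2 ^ 2), algebraMap (P3 k) (Q k) (X 0 ^ 2)]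

/-- `in(φ) = ((y², x², 0, 0), (0, 0, z², x²))`, over `R = G_m(Q) = k[x,y,z]`. -/
def inphi : Matrix (Fin 2) (Fin 4) (P3 k) :=
  !![X 1 ^ 2, X 0 ^ 2, 0, 0;
     0, 0, X 2 ^ 2, X 0 ^ 2]

/-- `in(ψ)`, with columns `(−x², y², 0, 0)` and `(0, 0, −x², z²)`. -/
def inpsi : Matrix (Fin 4) (Fin 2) (P3 k) :=
  !![-(X 0 ^ 2), 0;
     X 1 ^ 2, 0;
     0, -(X 0 ^ 2);
     0, X 2 ^ 2]

/-- `v` is a vector of homogeneous polynomials of degree `t`. -/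
def Homog {b : ℕ} (t : ℕ) (v : Fin b → P3 k) : Prop :=
  ∀ i, v i ∈ MvPolynomial.homogeneousSubmodule (Fin 3) k t

lemma P_eq : P k = MvPolynomial.idealOfVars (Fin 3) k := by
  unfold P MvPolynomial.idealOfVars
  congr 1
  ext p
  simp [Fin.exists_fin_succ, eq_comm]

lemma mem_P_pow (n : ℕ) (p : P3 k) :
    p ∈ P k ^ n ↔ ∀ i < n, homogeneousComponent i p = 0 := by
  rw [P_eq, MvPolynomial.mem_pow_idealOfVars_iff']
  constructor
  · intro h i hi
    ext d
    rw [coeff_homogeneousComponent]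
    split_ifs with hd
    · rw [h d (by omega)]; simp
    · simp
  · intro h d hd
    have := congrArg (coeff d) (h _ hd)
    rw [coeff_homogeneousComponent] at this
    simpa using this

lemma hc_mul {j : ℕ} {a : P3 k} (ha : a ∈ homogeneousSubmodule (Fin 3) k j) (b : P3 k) (n : ℕ) :
    homogeneousComponent n (a * b) = if j ≤ n then a * homogeneousComponent (n - j) b else 0 := by
  letI := MvPolynomial.gradedAlgebra (R := k) (σ := Fin 3)
  have := DirectSum.coe_decompose_mul_of_left_mem (homogeneousSubmodule (Fin 3) k) n (b := b) ha
  have h2 : ∀ (q : P3 k) (i : ℕ),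
      (DirectSum.decompose (homogeneousSubmodule (Fin 3) k) q i : P3 k)
        = homogeneousComponent i q := fun q i => decomposition.decompose'_apply q i
  simpa only [h2] using this

lemma hX (i : Fin 3) (n : ℕ) : (X i ^ n : P3 k) ∈ homogeneousSubmodule (Fin 3) k n :=
  isHomogeneous_X_pow i n

lemma dvd_lem {i j : Fin 3} (hij : i ≠ j) (a b : P3 k)
    (h : X j ^ 2 * a + X i ^ 2 * b = 0) : ∃ c, a = -(X i ^ 2) * c ∧ b = X j ^ 2 * c := by
  have hp : Prime (X i : P3 k) := MvPolynomial.X_prime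
  have hnd : ¬ (X i : P3 k) ∣ X j ^ 2 := fun hd =>
    hij (MvPolynomial.X_dvd_X.mp (hp.dvd_of_dvd_pow hd))
  have h1 : (X i : P3 k) ^ 2 ∣ X j ^ 2 * a := ⟨-b, by linear_combination h⟩
  obtain ⟨c, hc⟩ := hp.pow_dvd_of_dvd_mul_left 2 hnd h1
  refine ⟨-c, by rw [hc]; ring, ?_⟩
  have h0 : (X i ^ 2 : P3 k) ≠ 0 := pow_ne_zero _ hp.ne_zero
  apply mul_left_cancel₀ h0
  rw [hc] at h
  linear_combination h

section

lemma inv_mod (n : ℕ) (s : P3 k) (hs : s ∉ P k) : ∃ s' : P3 k, 1 - s * s' ∈ P k ^ n := by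
  have key : ∀ p : P3 k, p - C (coeff 0 p) ∈ P k := by
    intro p
    rw [← pow_one (P k), mem_P_pow]
    intro i hi
    obtain rfl : i = 0 := by omega
    simp [homogeneousComponent_zero]
  have hc : coeff 0 s ≠ 0 := by
    intro h0
    have := key s
    rw [h0] at this
    exact hs (by simpa using this)
  set c := coeff 0 s
  set e : P3 k := 1 - C c⁻¹ * s with he
  have heP : e ∈ P k := by
    have h1 : (C c⁻¹ * C c : P3 k) = 1 := by rw [← C_mul, inv_mul_cancel₀ hc, C_1]
    have : e = -(C c⁻¹) * (s - C c) := by rw [he]; linear_combination -h1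
    rw [this]
    exact Ideal.mul_mem_left _ _ (key s)
  refine ⟨C c⁻¹ * ∑ i ∈ Finset.range n, e ^ i, ?_⟩
  have := mul_neg_geom_sum e n
  have h2 : 1 - s * (C c⁻¹ * ∑ i ∈ Finset.range n, e ^ i) = e ^ n := by
    have : C c⁻¹ * s = 1 - e := by rw [he]; ring
    calc _ = 1 - (C c⁻¹ * s) * ∑ i ∈ Finset.range n, e ^ i := by ring
      _ = _ := by rw [this, mul_neg_geom_sum]; ring
  rw [h2]
  exact Ideal.pow_mem_pow heP n

lemma mQ_pow (n : ℕ) : mQ k ^ n = (P k ^ n).map (algebraMap (P3 k) (Q k)) := by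
  rw [Ideal.map_pow, mQ]
  congr 1
  exact (IsLocalization.AtPrime.map_eq_maximalIdeal (P k) (Q k)).symm

lemma alg_mem {n : ℕ} {p : P3 k} (h : p ∈ P k ^ n) : algebraMap (P3 k) (Q k) p ∈ mQ k ^ n := by
  rw [mQ_pow]; exact Ideal.mem_map_of_mem _ h

lemma alg_inj : Function.Injective (algebraMap (P3 k) (Q k)) :=
  IsLocalization.injective _ (Ideal.primeCompl_le_nonZeroDivisors (P k))

lemma mem_of_alg {n : ℕ} {p : P3 k} (h : algebraMap (P3 k) (Q k) p ∈ mQ k ^ n) :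
    p ∈ P k ^ n := by
  rw [mQ_pow, IsLocalization.mem_map_algebraMap_iff (P k).primeCompl] at h
  obtain ⟨⟨⟨a, ha⟩, ⟨s, hs⟩⟩, h⟩ := h
  simp only at h
  rw [← map_mul] at h
  have h := alg_inj k h
  obtain ⟨s', hs'⟩ := inv_mod k n s hs
  have : p = s' * a + p * (1 - s * s') := by rw [← h]; ring
  rw [this]
  exact add_mem (Ideal.mul_mem_left _ _ ha) (Ideal.mul_mem_left _ _ hs')

lemma approx (n : ℕ) (q : Q k) : ∃ r : P3 k, q - algebraMap (P3 k) (Q k) r ∈ mQ k ^ n := by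
  obtain ⟨r, ⟨s, hs⟩, rfl⟩ := IsLocalization.exists_mk'_eq (P k).primeCompl q
  obtain ⟨s', hs'⟩ := inv_mod k n s hs
  refine ⟨r * s', ?_⟩
  have h1 := IsLocalization.mk'_spec (Q k) r (⟨s, hs⟩ : (P k).primeCompl)
  simp only at h1
  have : IsLocalization.mk' (Q k) r (⟨s, hs⟩ : (P k).primeCompl) - algebraMap (P3 k) (Q k) (r * s')
      = IsLocalization.mk' (Q k) r (⟨s, hs⟩ : (P k).primeCompl) *
        algebraMap (P3 k) (Q k) (1 - s * s') := by
    simp only [map_mul, map_sub, map_one]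
    linear_combination (algebraMap (P3 k) (Q k) s') * h1
  rw [this]
  exact Ideal.mul_mem_left _ _ (alg_mem k hs')

lemma mem_smul {M : Type} [AddCommGroup M] [Module (Q k) M]
    (π : (Fin 2 → Q k) →ₗ[Q k] M) (hsurj : Function.Surjective π) (I : Ideal (Q k)) (x : M) :
    x ∈ (I • ⊤ : Submodule (Q k) M) ↔ ∃ u : Fin 2 → Q k, (∀ i, u i ∈ I) ∧ π u = x := by
  constructor
  · intro h
    induction h using Submodule.smul_induction_on' with
    | smul r hr n hn =>
      obtain ⟨u, rfl⟩ := hsurj n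
      exact ⟨r • u, fun i => I.mul_mem_right _ hr, by simp⟩
    | add a _ b _ ha hb =>
      obtain ⟨u, hu, rfl⟩ := ha
      obtain ⟨w, hw, rfl⟩ := hb
      exact ⟨u + w, fun i => add_mem (hu i) (hw i), by simp⟩
  · rintro ⟨u, hu, rfl⟩
    rw [pi_eq_sum_univ' u, map_sum]
    refine Submodule.sum_mem _ fun i _ => ?_
    rw [map_smul]
    exact Submodule.smul_mem_smul (hu i) trivial

lemma poly_exact (t : ℕ) (v : Fin 2 → P3 k) (hv : Homog k t v) (r : Fin 4 → P3 k)
    (h0 : v 0 - (X 1 ^ 2 * r 0 + X 0 ^ 2 * r 1 + X 2 ^ 3 * r 2) ∈ P k ^ (t + 1))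
    (h1 : v 1 - (X 2 ^ 2 * r 2 + X 0 ^ 2 * r 3) ∈ P k ^ (t + 1)) :
    v ∈ LinearMap.range (Matrix.mulVecLin (inphi k)) := by
  rw [mem_P_pow] at h0 h1
  have e0 := h0 t (by omega)
  have e1 := h1 t (by omega)
  have hvt : ∀ i, homogeneousComponent t (v i) = v i := fun i => by
    rw [homogeneousComponent_of_mem (hv i), if_pos rfl]
  simp only [map_sub, map_add, hc_mul k (hX k _ _), hvt] at e0 e1
  have key : ∃ a b c, v 0 = X 1 ^ 2 * a + X 0 ^ 2 * b + X 0 ^ 2 * c := by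
    by_cases ht : 3 ≤ t
    · have e2 := h1 (t - 1) (by omega)
      simp only [map_sub, map_add, hc_mul k (hX k _ _), homogeneousComponent_of_mem (hv 1)] at e2
      rw [if_neg (by omega), if_pos (by omega), if_pos (by omega),
        show t - 1 - 2 = t - 3 by omega] at e2
      obtain ⟨c, hc, -⟩ := dvd_lem k (i := 0) (j := 2) (by decide)
        (homogeneousComponent (t - 3) (r 2)) (homogeneousComponent (t - 3) (r 3))
        (by linear_combination -e2)
      rw [if_pos (by omega), if_pos (by omega), if_pos ht, hc] at e0
      exact ⟨homogeneousComponent (t - 2) (r 0), homogeneousComponent (t - 2) (r 1), -X 2 ^ 3 * c, by linear_combination e0⟩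
    · rw [if_neg ht] at e0
      split_ifs at e0
      · exact ⟨homogeneousComponent (t - 2) (r 0), homogeneousComponent (t - 2) (r 1), 0, by linear_combination e0⟩
      · exact ⟨0, 0, 0, by linear_combination e0⟩
  obtain ⟨a, b, c, hk⟩ := key
  have key1 : ∃ a b, v 1 = X 2 ^ 2 * a + X 0 ^ 2 * b := by
    split_ifs at e1
    · exact ⟨homogeneousComponent (t - 2) (r 2), homogeneousComponent (t - 2) (r 3), by linear_combination e1⟩
    · exact ⟨0, 0, by linear_combination e1⟩
  obtain ⟨a', b', hk'⟩ := key1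
  refine ⟨![a, b + c, a', b'], ?_⟩
  ext1 i
  fin_cases i
  · simp [inphi, Matrix.mulVec, dotProduct, Fin.sum_univ_succ, hk]; ring
  · simp [inphi, Matrix.mulVec, dotProduct, Fin.sum_univ_succ, hk']
end

theorem explicit_minimal_resolution_of_G
    (k : Type) [Field k] [hP : (P k).IsPrime]
    (M : Type) [AddCommGroup M] [Module (Q k) M]
    (π : (Fin 2 → Q k) →ₗ[Q k] M)
    (hsurj : Function.Surjective π)
    (hker : LinearMap.ker π = LinearMap.range (Matrix.mulVecLin (phi k))) :
    -- the complex is exact at `R(−2)^4` …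
    LinearMap.ker (Matrix.mulVecLin (inphi k)) = LinearMap.range (Matrix.mulVecLin (inpsi k))
    -- … and at `R(−4)^2`:
    ∧ Function.Injective (Matrix.mulVecLin (inpsi k))
    -- `ε ∘ in(φ) = 0`:
    ∧ (∀ (t : ℕ) (w : Fin 4 → P3 k), Homog k t w →
        π (fun i => algebraMap (P3 k) (Q k) ((inphi k).mulVec w i)) ∈
          ((mQ k) ^ (t + 3) • ⊤ : Submodule (Q k) M))
    -- exactness at `R^2`: `ker ε ⊆ image in(φ)`:
    ∧ (∀ (t : ℕ) (v : Fin 2 → P3 k), Homog k t v →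
        π (fun i => algebraMap (P3 k) (Q k) (v i)) ∈ ((mQ k) ^ (t + 1) • ⊤ : Submodule (Q k) M) →
        v ∈ LinearMap.range (Matrix.mulVecLin (inphi k)))
    -- `ε` is surjective onto `G_m(M)`:
    ∧ (∀ (t : ℕ), ∀ x ∈ ((mQ k) ^ t • ⊤ : Submodule (Q k) M),
        ∃ v : Fin 2 → P3 k, Homog k t v ∧
          x - π (fun i => algebraMap (P3 k) (Q k) (v i)) ∈
            ((mQ k) ^ (t + 1) • ⊤ : Submodule (Q k) M))
    -- the resolution is pure of type `(0, 2, 4)` and minimal: the differentials are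
    -- homogeneous of (positive) degrees `2 − 0 = 2` and `4 − 2 = 2`:
    ∧ (∀ i j, inphi k i j ∈ MvPolynomial.homogeneousSubmodule (Fin 3) k 2)
    ∧ (∀ i j, inpsi k i j ∈ MvPolynomial.homogeneousSubmodule (Fin 3) k 2) := by
  refine ⟨?_, ?_, ?_, ?_, ?_, ?_, ?_⟩
  · ext w
    simp only [LinearMap.mem_ker, LinearMap.mem_range]
    constructor
    · intro h
      have h0 := congrFun h 0
      have h1 := congrFun h 1
      simp [inphi, Matrix.mulVec, dotProduct, Fin.sum_univ_succ] at h0 h1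
      obtain ⟨c, hc, hc'⟩ := dvd_lem k (i := 0) (j := 1) (by decide) _ _ h0
      obtain ⟨d, hd, hd'⟩ := dvd_lem k (i := 0) (j := 2) (by decide) _ _ h1
      refine ⟨![c, d], ?_⟩
      ext1 i
      fin_cases i
      · simpa [inpsi, Matrix.mulVec, dotProduct, Fin.sum_univ_succ] using hc.symm
      · simpa [inpsi, Matrix.mulVec, dotProduct, Fin.sum_univ_succ] using hc'.symm
      · simpa [inpsi, Matrix.mulVec, dotProduct, Fin.sum_univ_succ] using hd.symm
      · simpa [inpsi, Matrix.mulVec, dotProduct, Fin.sum_univ_succ] using hd'.symm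
    · rintro ⟨u, rfl⟩
      ext1 i
      fin_cases i <;>
      · simp [inphi, inpsi, Matrix.mulVec, dotProduct, Fin.sum_univ_succ]
        ring
  · rw [← LinearMap.ker_eq_bot, LinearMap.ker_eq_bot']
    intro u hu
    have h1 := congrFun hu 1
    have h3 := congrFun hu 3
    simp [inpsi, Matrix.mulVec, dotProduct, Fin.sum_univ_succ] at h1 h3
    ext1 i
    fin_cases i
    · exact h1
    · exact h3
  · intro t w hw
    rw [mem_smul k π hsurj]
    refine ⟨![-algebraMap (P3 k) (Q k) (X 2 ^ 3 * w 2), 0], ?_, ?_⟩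
    · intro i
      fin_cases i
      · refine neg_mem (alg_mem k ?_)
        rw [mem_P_pow]
        intro i hi
        rw [hc_mul k (hX k _ _), homogeneousComponent_of_mem (hw 2)]
        split_ifs
        · omega
        · simp
        · rfl
      · simp
    · rw [← sub_eq_zero, ← map_sub, ← LinearMap.mem_ker, hker]
      refine ⟨fun i => - algebraMap (P3 k) (Q k) (w i), ?_⟩
      ext1 i
      fin_cases i
      · simp [phi, inphi, Matrix.mulVec, dotProduct, Fin.sum_univ_succ]
        ring
      · simp [phi, inphi, Matrix.mulVec, dotProduct, Fin.sum_univ_succ]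
        ring
  · intro t v hv h
    rw [mem_smul k π hsurj] at h
    obtain ⟨u, hu, h⟩ := h
    rw [eq_comm, ← sub_eq_zero, ← map_sub, ← LinearMap.mem_ker, hker] at h
    obtain ⟨q, hq⟩ := h
    choose r hr using fun i => approx k (t + 1) (q i)
    have q0 := congrFun hq 0
    have q1 := congrFun hq 1
    simp [phi, Matrix.mulVec, dotProduct, Fin.sum_univ_succ] at q0 q1
    refine poly_exact k t v hv r (mem_of_alg k ?_) (mem_of_alg k ?_)
    · have : algebraMap (P3 k) (Q k) (v 0 - (X 1 ^ 2 * r 0 + X 0 ^ 2 * r 1 + X 2 ^ 3 * r 2)) =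
        u 0 + (algebraMap (P3 k) (Q k) (X 1) ^ 2 * (q 0 - algebraMap (P3 k) (Q k) (r 0))
         + algebraMap (P3 k) (Q k) (X 0) ^ 2 * (q 1 - algebraMap (P3 k) (Q k) (r 1))
         + algebraMap (P3 k) (Q k) (X 2) ^ 3 * (q 2 - algebraMap (P3 k) (Q k) (r 2))) := by
        simp only [map_sub, map_add, map_mul, map_pow]
        linear_combination -q0
      rw [this]
      exact add_mem (hu 0) (add_mem (add_mem (Ideal.mul_mem_left _ _ (hr 0))
        (Ideal.mul_mem_left _ _ (hr 1))) (Ideal.mul_mem_left _ _ (hr 2)))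
    · have : algebraMap (P3 k) (Q k) (v 1 - (X 2 ^ 2 * r 2 + X 0 ^ 2 * r 3)) =
        u 1 + (algebraMap (P3 k) (Q k) (X 2) ^ 2 * (q 2 - algebraMap (P3 k) (Q k) (r 2))
         + algebraMap (P3 k) (Q k) (X 0) ^ 2 * (q 3 - algebraMap (P3 k) (Q k) (r 3))) := by
        simp only [map_sub, map_add, map_mul, map_pow]
        linear_combination -q1
      rw [this]
      exact add_mem (hu 1) (add_mem (Ideal.mul_mem_left _ _ (hr 2))
        (Ideal.mul_mem_left _ _ (hr 3)))
  · intro t x hx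
    rw [mem_smul k π hsurj] at hx
    obtain ⟨u, hu, rfl⟩ := hx
    choose r hr using fun i => approx k (t + 1) (u i)
    refine ⟨fun i => homogeneousComponent t (r i), fun i => homogeneousComponent_mem t (r i), ?_⟩
    rw [← map_sub, mem_smul k π hsurj]
    refine ⟨_, fun i => ?_, rfl⟩
    have hrt : r i ∈ P k ^ t := by
      apply mem_of_alg
      have := sub_mem (hu i) (Ideal.pow_le_pow_right (Nat.le_succ t) (hr i))
      simpa using this
    have h2 : r i - homogeneousComponent t (r i) ∈ P k ^ (t + 1) := by
      rw [mem_P_pow] at hrt ⊢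
      intro j hj
      rw [map_sub, homogeneousComponent_of_mem (homogeneousComponent_mem t (r i))]
      split_ifs with hjt
      · rw [hjt]; simp
      · rw [hrt j (by omega)]; simp
    have := add_mem (hr i) (alg_mem k h2)
    simpa using this
  · intro i j
    fin_cases i <;> fin_cases j <;> simp [inphi, isHomogeneous_X_pow, isHomogeneous_zero]
  · intro i j
    have hn : ∀ i : Fin 3, (-(X i ^ 2) : P3 k).IsHomogeneous 2 := fun i => neg_mem (hX k i 2)
    fin_cases i <;> fin_cases j <;> simp [inpsi, isHomogeneous_X_pow, isHomogeneous_zero, hn]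

end PureResLoc19
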